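/- Let C0 > 0 and 0 < α ≤ 2. There exists δ > 0, depending only on α and C0, with the following property: if f : [0,∞) → [0,∞) is locally Lipschitz, satisfies f(t) − f(s) ≤ C0 ∫_s^t (1+τ)^(−α) dτ for all 0 ≤ s ≤ t, and if T ≥ 1 satisfies f(T) (1+T)^(α−1) ≤ δ, then ∫_0^T f(τ) dτ ≥ f(T)² (1+T)^α / (3 C0). -/

import Mathlib

open MeasureTheory Filter Set

/-- On the last sixth of `[0, R]`, the power `x ^ (-α)` is at most `3/2` of its value at `R`. -/
lemma rpow_neg_le_three_halves_mul {α R x : ℝ} (hα0 : 0 < α) (hα2 : α ≤ 2) (hR : 0 < R)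
    (hx : 5 / 6 * R ≤ x) : x ^ (-α) ≤ 3 / 2 * R ^ (-α) := by
  calc x ^ (-α) ≤ (5 / 6 * R) ^ (-α) :=
        Real.rpow_le_rpow_of_nonpos (by positivity) hx (by linarith)
    _ = (5 / 6 : ℝ) ^ (-α) * R ^ (-α) := Real.mul_rpow (by norm_num) hR.le
    _ ≤ 3 / 2 * R ^ (-α) := by
        gcongr
        calc (5 / 6 : ℝ) ^ (-α) ≤ (5 / 6 : ℝ) ^ (-2 : ℝ) :=
              Real.rpow_le_rpow_of_exponent_ge (by norm_num) (by norm_num) (by linarith)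
          _ ≤ 3 / 2 := by
              rw [Real.rpow_neg (by norm_num)]
              norm_num

/-- The integral of `(1 + τ) ^ (-α)` over a short interval ending at `T`. -/
lemma integral_one_add_rpow_neg_le {α s T : ℝ} (hα0 : 0 < α) (hα2 : α ≤ 2) (hT : 0 ≤ T)
    (hsT : s ≤ T) (hs : 5 / 6 * (1 + T) ≤ 1 + s) :
    ∫ τ in s..T, (1 + τ) ^ (-α) ≤ (T - s) * (3 / 2 * (1 + T) ^ (-α)) := by
  have hcont : ContinuousOn (fun τ : ℝ => (1 + τ) ^ (-α)) (Icc s T) := by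
    refine ContinuousOn.rpow_const (by fun_prop) fun τ hτ => Or.inl ?_
    have := hτ.1
    linarith
  calc ∫ τ in s..T, (1 + τ) ^ (-α) ≤ ∫ _ in s..T, 3 / 2 * (1 + T) ^ (-α) := by
        refine intervalIntegral.integral_mono_on hsT (hcont.intervalIntegrable_of_Icc hsT)
          (by simp) fun τ hτ => ?_
        exact rpow_neg_le_three_halves_mul hα0 hα2 (by linarith) (by linarith [hτ.1])
    _ = (T - s) * (3 / 2 * (1 + T) ^ (-α)) := by
        rw [intervalIntegral.integral_const, smul_eq_mul]

/-- The area under a line of slope `c` over an interval of length `h`. -/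
lemma integral_sub_mul_sub (a c T h : ℝ) :
    ∫ τ in (T - h)..T, (a - c * (T - τ)) = a * h - c * h ^ 2 / 2 := by
  have hderiv : ∀ τ ∈ uIcc (T - h) T,
      HasDerivAt (fun τ => a * τ + c * (T - τ) ^ 2 / 2) (a - c * (T - τ)) τ := by
    intro τ _
    have h1 := (hasDerivAt_id' τ).const_mul a
    have h2 := ((((hasDerivAt_id' τ).const_sub T).pow 2).const_mul c).div_const 2
    refine (h1.add h2).congr_deriv ?_
    norm_num
    ring
  rw [intervalIntegral.integral_eq_sub_of_hasDerivAt hderiv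
    (Continuous.intervalIntegrable (by fun_prop) _ _)]
  ring



/-- **Triangle area lower bound** in the proof of the Area Inequality (Theorem 1.3 of the
paper). There is a `δ > 0`, depending only on `α` and `C0`, such that for every nonnegative
locally Lipschitz `f` on `[0,∞)` with `f t - f s ≤ C0 ∫_s^t (1+τ)^(-α) dτ`, and every
`T ≥ 1` with `f T (1+T)^(α-1) ≤ δ`, one has `∫_0^T f ≥ f(T)² (1+T)^α / (3 C0)`. -/
theorem area_triangle_bound
    (C0 α : ℝ) (hC0 : 0 < C0) (hα0 : 0 < α) (hα2 : α ≤ 2) :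
    ∃ δ > (0:ℝ), ∀ f : ℝ → ℝ,
      (∀ t ∈ Ici (0:ℝ), 0 ≤ f t) →
      LocallyLipschitzOn (Ici 0) f →
      (∀ s t : ℝ, 0 ≤ s → s ≤ t →
        f t - f s ≤ C0 * ∫ τ in s..t, (1 + τ) ^ (-α)) →
      ∀ T : ℝ, 1 ≤ T → f T * (1 + T) ^ (α - 1) ≤ δ →
        f T ^ 2 * (1 + T) ^ α / (3 * C0) ≤ ∫ τ in (0:ℝ)..T, f τ := by
  refine ⟨C0 / 4, by positivity, fun f hf hlip hgrow T hT hδ => ?_⟩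
  have hR : 0 < 1 + T := by linarith
  have hF : 0 ≤ f T := hf T (zero_le_one.trans hT)
  have hP : 0 < (1 + T) ^ α := Real.rpow_pos_of_pos hR α
  obtain ⟨h, hh⟩ : ∃ h, h = 2 / 3 * f T * (1 + T) ^ α / C0 := ⟨_, rfl⟩
  have hh0 : 0 ≤ h := by rw [hh]; positivity
  have hhR : h ≤ (1 + T) / 6 := by
    rw [Real.rpow_sub_one hR.ne', ← mul_div_assoc, div_le_iff₀ hR] at hδ
    rw [hh, div_le_iff₀ hC0]
    linarith
  have hT0 : 0 ≤ T - h := by linarith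
  have hint : ∀ a b : ℝ, 0 ≤ a → a ≤ b → IntervalIntegrable f volume a b := fun a b ha hab =>
    (hlip.continuousOn.mono fun _ hx => ha.trans hx.1).intervalIntegrable_of_Icc hab
  have hline : ∀ τ ∈ Icc (T - h) T,
      f T - C0 * (3 / 2 * (1 + T) ^ (-α)) * (T - τ) ≤ f τ := by
    intro τ hτ
    have h1 := hgrow τ T (hT0.trans hτ.1) hτ.2
    have h2 := mul_le_mul_of_nonneg_left (integral_one_add_rpow_neg_le hα0 hα2
      (zero_le_one.trans hT) hτ.2 (by linarith [hτ.1])) hC0.le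
    linarith
  calc f T ^ 2 * (1 + T) ^ α / (3 * C0)
      = ∫ τ in (T - h)..T, (f T - C0 * (3 / 2 * (1 + T) ^ (-α)) * (T - τ)) := by
        rw [integral_sub_mul_sub, hh, Real.rpow_neg hR.le]
        field_simp
        ring
    _ ≤ ∫ τ in (T - h)..T, f τ :=
        intervalIntegral.integral_mono_on (by linarith)
          (Continuous.intervalIntegrable (by fun_prop) _ _)
          (hint _ _ hT0 (by linarith)) hline
    _ ≤ ∫ τ in (0:ℝ)..T, f τ := by
        rw [← intervalIntegral.integral_add_adjacent_intervals (hint 0 (T - h) le_rfl hT0)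
          (hint (T - h) T hT0 (by linarith))]
        exact le_add_of_nonneg_left
          (intervalIntegral.integral_nonneg hT0 fun τ hτ => hf τ hτ.1)
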